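/- Fix a real number κ > 1, and let R be a positive real-valued function on the primes such that R(p)·p^κ → 1 as p → ∞. For x > 0 define P(x) = Π_p (1 + R(p)·x), the product over all primes (which converges since κ > 1). Then log P(x) ≍ x^{1/κ} / log x as x → ∞: there exist constants c₁, c₂ > 0 and x₀ such that for all x ≥ x₀, c₁ · x^{1/κ}/log x ≤ log P(x) ≤ c₂ · x^{1/κ}/log x. -/

import Mathlib

open scoped BigOperators

/-- Comparison of weighted sums by Abel summation: if the partial sums of `a` are at most those of
the constant `K`, the same holds after weighting by a nonnegative antitone sequence. -/
theorem sum_range_mul_le_of_antitone {a g : ℕ → ℝ} {K : ℝ} (hg : Antitone g)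
    (hg0 : ∀ n, 0 ≤ g n) (ha : ∀ n, ∑ i ∈ Finset.range n, a i ≤ K * n) (N : ℕ) :
    ∑ i ∈ Finset.range N, a i * g i ≤ K * ∑ i ∈ Finset.range N, g i := by
  have key : ∀ n, ∑ i ∈ Finset.range (n + 1), a i * g i +
      (K * (n + 1) - ∑ i ∈ Finset.range (n + 1), a i) * g n ≤
      K * ∑ i ∈ Finset.range (n + 1), g i := by
    intro n
    induction n with
    | zero => simp; linarith
    | succ n ih =>
      have h1 := ha (n + 1)
      have h2 := mul_le_mul_of_nonneg_left (hg (Nat.le_succ n)) (sub_nonneg.2 h1)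
      rw [Finset.sum_range_succ _ (n + 1), Finset.sum_range_succ g (n + 1),
        Finset.sum_range_succ a (n + 1)]
      push_cast at *
      simp only [Nat.succ_eq_add_one] at h2
      linarith
  cases N with
  | zero => simp
  | succ n =>
    have h1 := ha (n + 1)
    push_cast at h1
    have h2 := mul_nonneg (sub_nonneg.2 h1) (hg0 n)
    linarith [key n]

theorem sum_range_sqrt_div_le {y : ℝ} (hy : 0 ≤ y) (M : ℕ) :
    ∑ i ∈ Finset.range M, √(y / ((i + 1 : ℕ) : ℝ)) ≤ 2 * √(y * M) := by
  induction M with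
  | zero => simp
  | succ M ih =>
    rw [Finset.sum_range_succ]
    refine (add_le_add_left ih _).trans ?_
    rw [Real.sqrt_div hy, Real.sqrt_mul hy, Real.sqrt_mul hy]
    have hs : 0 < √((M + 1 : ℕ) : ℝ) := by positivity
    have h1 : √((M + 1 : ℕ) : ℝ) ^ 2 = M + 1 := by rw [Real.sq_sqrt (by positivity)]; push_cast; rfl
    have h2 : √(M : ℝ) ^ 2 = M := Real.sq_sqrt (by positivity)
    have h3 : 2 * √(M : ℝ) + 1 / √((M + 1 : ℕ) : ℝ) ≤ 2 * √((M + 1 : ℕ) : ℝ) := by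
      rw [← le_sub_iff_add_le', div_le_iff₀ hs]
      nlinarith [sq_nonneg (√((M + 1 : ℕ) : ℝ) - √(M : ℝ))]
    calc 2 * (√y * √(M : ℝ)) + √y / √((M + 1 : ℕ) : ℝ)
        = √y * (2 * √(M : ℝ) + 1 / √((M + 1 : ℕ) : ℝ)) := by ring
      _ ≤ √y * (2 * √((M + 1 : ℕ) : ℝ)) := by gcongr
      _ = _ := by ring

theorem sum_range_add_rpow_neg_le {κ : ℝ} (hκ : 1 < κ) {M : ℕ} (hM : 0 < M) (N : ℕ) :
    ∑ i ∈ Finset.range N, ((M : ℝ) + ((i + 1 : ℕ) : ℝ)) ^ (-κ) ≤ (M : ℝ) ^ (1 - κ) / (κ - 1) := by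
  have hM' : (0 : ℝ) < M := by exact_mod_cast hM
  have hanti : AntitoneOn (fun u : ℝ => u ^ (-κ)) (Set.Icc (M : ℝ) (M + N)) := by
    intro a ha b _ hab
    exact Real.rpow_le_rpow_of_nonpos (hM'.trans_le ha.1) hab (by linarith)
  refine hanti.sum_le_integral.trans ?_
  rw [integral_rpow]
  · have h : 0 ≤ ((M : ℝ) + N) ^ (1 - κ) := by positivity
    rw [show -κ + 1 = 1 - κ by ring, show ∀ z : ℝ, z / (1 - κ) = -z / (κ - 1) from fun z => by
      rw [← neg_sub κ 1, div_neg, neg_div]]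
    exact div_le_div_of_nonneg_right (by linarith) (by linarith)
  · right
    refine ⟨by linarith, ?_⟩
    rw [Set.uIcc_of_le (by simp)]
    intro h
    linarith [h.1]

theorem sum_range_min_sqrt_rpow_le {κ : ℝ} (hκ : 1 < κ) {y : ℝ} (hy : 1 ≤ y) (N : ℕ) :
    ∑ i ∈ Finset.range N, min √(y / ((i + 1 : ℕ) : ℝ)) ((y / ((i + 1 : ℕ) : ℝ)) ^ κ) ≤
      (2 + 2 ^ (κ - 1) / (κ - 1)) * y := by
  have hy0 : 0 < y := by linarith
  set M := ⌊y⌋₊ with hM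
  have hMpos : 0 < M := Nat.floor_pos.2 hy
  have hM1 : (1 : ℝ) ≤ M := by exact_mod_cast hMpos
  have hMy : (M : ℝ) ≤ y := Nat.floor_le hy0.le
  have hyM : y ≤ 2 * M := by linarith [Nat.lt_floor_add_one y]
  have hκ' : 0 < κ - 1 := by linarith
  calc _ ≤ ∑ i ∈ Finset.range (M + N),
        min √(y / ((i + 1 : ℕ) : ℝ)) ((y / ((i + 1 : ℕ) : ℝ)) ^ κ) := by
        refine Finset.sum_le_sum_of_subset_of_nonneg
          (Finset.range_subset_range.2 (by omega)) fun i _ _ => ?_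
        positivity
    _ ≤ ∑ i ∈ Finset.range M, √(y / ((i + 1 : ℕ) : ℝ)) +
        ∑ i ∈ Finset.range N, y ^ κ * ((M : ℝ) + ((i + 1 : ℕ) : ℝ)) ^ (-κ) := by
        rw [Finset.sum_range_add]
        gcongr with i _ i _
        · exact min_le_left _ _
        · refine (min_le_right _ _).trans (le_of_eq ?_)
          rw [Real.div_rpow hy0.le (by positivity), Real.rpow_neg (by positivity), div_eq_mul_inv]
          push_cast
          ring_nf
    _ ≤ 2 * y + y ^ κ * ((M : ℝ) ^ (1 - κ) / (κ - 1)) := by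
        rw [← Finset.mul_sum]
        gcongr
        · refine (sum_range_sqrt_div_le hy0.le M).trans ?_
          gcongr
          rw [Real.sqrt_le_left hy0.le]
          nlinarith
        · exact sum_range_add_rpow_neg_le hκ hMpos N
    _ = (2 + (y / M) ^ (κ - 1) / (κ - 1)) * y := by
        rw [Real.div_rpow hy0.le (by positivity), Real.rpow_sub_one hy0.ne',
          show 1 - κ = -(κ - 1) by ring, Real.rpow_neg (by positivity)]
        field_simp
    _ ≤ _ := by
        gcongr
        rw [div_le_iff₀ (by linarith)]
        exact hyM

theorem sum_primesLE_log_mul_le {g : ℕ → ℝ} (hg : Antitone fun i => g (i + 1))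
    (hg0 : ∀ n, 0 ≤ g (n + 1)) (N : ℕ) :
    ∑ p ∈ Nat.primesLE N, Real.log p * g p ≤
      Real.log 4 * ∑ i ∈ Finset.range N, g (i + 1) := by
  have hshift : ∀ (f : ℕ → ℝ) (n : ℕ), ∑ p ∈ Nat.primesLE n, f p =
      ∑ i ∈ Finset.range n, if (i + 1).Prime then f (i + 1) else 0 := by
    intro f n
    rw [Nat.primesLE_eq_filter_range, Finset.sum_filter, Finset.sum_range_succ']
    simp [Nat.not_prime_zero]
  rw [hshift fun p => Real.log p * g p]
  convert sum_range_mul_le_of_antitone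
    (a := fun i => if (i + 1).Prime then Real.log ((i + 1 : ℕ) : ℝ) else 0) hg hg0 ?_ N using 2
  · simp
  · intro n
    rw [← hshift fun p => Real.log p, ← Chebyshev.theta_eq_sum_primesLE_log]
    exact Chebyshev.theta_le_log4_mul_x (by positivity)

theorem log_one_add_mul_rpow_le {κ C t : ℝ} (hκ : 1 ≤ κ) (hC : 0 ≤ C) (ht : 0 < t) :
    Real.log (1 + C * t ^ κ) * (1 + 2 * max (Real.log t) 0) ≤
      9 * (C + 4 * κ) * min √t (t ^ κ) := by
  have htκ : 0 < t ^ κ := by positivity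
  rcases le_total t 1 with h | h
  · have h1 : min √t (t ^ κ) = t ^ κ := by
      rw [min_eq_right]
      rw [Real.sqrt_eq_rpow]
      exact Real.rpow_le_rpow_of_exponent_ge ht h (by linarith)
    rw [h1, max_eq_right (Real.log_nonpos ht.le h)]
    have h2 := Real.log_le_sub_one_of_pos (show 0 < 1 + C * t ^ κ by positivity)
    nlinarith [mul_nonneg hC htκ.le, mul_pos (show 0 < κ by linarith) htκ]
  · have h1 : min √t (t ^ κ) = √t := by
      rw [min_eq_left]
      rw [Real.sqrt_eq_rpow]
      exact Real.rpow_le_rpow_of_exponent_le h (by linarith)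
    have hlog : Real.log t ≤ 4 * t ^ (1 / 4 : ℝ) := by
      have := Real.log_le_rpow_div ht.le (show (0 : ℝ) < 1 / 4 by norm_num)
      linarith
    have hs1 : 1 ≤ t ^ (1 / 4 : ℝ) := Real.one_le_rpow h (by norm_num)
    have hs2 : t ^ (1 / 4 : ℝ) * t ^ (1 / 4 : ℝ) = √t := by
      rw [← Real.rpow_add ht, Real.sqrt_eq_rpow]; norm_num
    have hl0 := Real.log_nonneg h
    rw [h1, max_eq_left hl0, ← hs2]
    have h3 : Real.log (1 + C * t ^ κ) ≤ C + κ * Real.log t := by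
      have h4 : 1 ≤ t ^ κ := Real.one_le_rpow h (by linarith)
      calc Real.log (1 + C * t ^ κ) ≤ Real.log ((1 + C) * t ^ κ) :=
            Real.log_le_log (by positivity) (by linarith)
        _ = Real.log (1 + C) + κ * Real.log t := by
            rw [Real.log_mul (by positivity) htκ.ne', Real.log_rpow ht]
        _ ≤ _ := by linarith [Real.log_le_sub_one_of_pos (show 0 < 1 + C by positivity)]
    calc _ ≤ ((C + 4 * κ) * t ^ (1 / 4 : ℝ)) * (9 * t ^ (1 / 4 : ℝ)) := by
          gcongr
          · nlinarith
          · linarith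
      _ = _ := by ring

theorem log_one_add_mul_div_rpow_le {κ C y : ℝ} (hκ : 1 ≤ κ) (hC : 0 ≤ C) (hy : 1 < y) {p : ℕ}
    (hp : 2 ≤ p) :
    Real.log (1 + C * (y / p) ^ κ) ≤
      9 * (C + 4 * κ) / Real.log y * (Real.log p * min √(y / p) ((y / p) ^ κ)) := by
  have hp0 : (0 : ℝ) < p := by positivity
  have hp2 : (2 : ℝ) ≤ p := by exact_mod_cast hp
  have hly := Real.log_pos hy
  have hlp : 1 / 2 ≤ Real.log p := by
    have := Real.log_two_gt_d9
    have := Real.log_le_log two_pos hp2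
    linarith
  have ht : 0 < y / p := by positivity
  have h1 := log_one_add_mul_rpow_le hκ hC ht
  have h2 : Real.log y ≤ Real.log p * (1 + 2 * max (Real.log (y / p)) 0) := by
    have h3 : Real.log (y / p) = Real.log y - Real.log p := Real.log_div (by positivity) hp0.ne'
    have h4 := le_max_left (Real.log (y / p)) 0
    have h5 := le_max_right (Real.log (y / p)) 0
    nlinarith
  have h0 : 0 ≤ Real.log (1 + C * (y / p) ^ κ) :=
    Real.log_nonneg (by have : 0 ≤ C * (y / p) ^ κ := by positivity
                        linarith)
  rw [div_mul_eq_mul_div, le_div_iff₀ hly]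
  calc _ ≤ Real.log (1 + C * (y / p) ^ κ) *
        (Real.log p * (1 + 2 * max (Real.log (y / p)) 0)) := by gcongr
    _ = Real.log p * (Real.log (1 + C * (y / p) ^ κ) *
        (1 + 2 * max (Real.log (y / p)) 0)) := by ring
    _ ≤ Real.log p * (9 * (C + 4 * κ) * min √(y / p) ((y / p) ^ κ)) := by gcongr
    _ = _ := by ring

theorem sum_primesLE_log_one_add_le {κ C y : ℝ} (hκ : 1 < κ) (hC : 0 ≤ C) (hy : 1 < y) (N : ℕ) :
    ∑ p ∈ Nat.primesLE N, Real.log (1 + C * (y / p) ^ κ) ≤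
      9 * (C + 4 * κ) * Real.log 4 * (2 + 2 ^ (κ - 1) / (κ - 1)) * (y / Real.log y) := by
  have hly := Real.log_pos hy
  have hy0 : 0 < y := by linarith
  calc _ ≤ ∑ p ∈ Nat.primesLE N, 9 * (C + 4 * κ) / Real.log y *
        (Real.log p * min √(y / p) ((y / p) ^ κ)) :=
        Finset.sum_le_sum fun p hp =>
          log_one_add_mul_div_rpow_le hκ.le hC hy (Nat.two_le_of_mem_primesLE hp)
    _ ≤ 9 * (C + 4 * κ) / Real.log y *
        (Real.log 4 * ((2 + 2 ^ (κ - 1) / (κ - 1)) * y)) := by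
        rw [← Finset.mul_sum]
        gcongr
        refine (sum_primesLE_log_mul_le (g := fun n => min √(y / n) ((y / n) ^ κ))
          ?_ (fun n => by positivity) N).trans ?_
        · intro i j hij
          dsimp only
          gcongr
        · gcongr
          exact sum_range_min_sqrt_rpow_le hκ hy.le N
    _ = _ := by ring

theorem div_four_mul_log_le_primeCounting {y : ℝ} (hy : 10 ≤ y) :
    y / (4 * Real.log y) ≤ Nat.primeCounting ⌊y⌋₊ := by
  have hly := Real.log_pos (show 1 < y by linarith)
  refine le_trans ?_ (Chebyshev.pi_ge' (by linarith))
  rw [← div_div]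
  gcongr
  have h1 := Real.log_le_sub_one_of_pos (show 0 < (y + 2) / 16 by linarith)
  rw [Real.log_div (by linarith) (by norm_num), show (16 : ℝ) = 2 ^ 4 by norm_num,
    Real.log_pow] at h1
  push_cast at h1
  have h2 := Real.log_two_gt_d9
  have h3 := Real.log_two_lt_d9
  nlinarith

theorem exists_forall_le_of_tendsto_inf_principal {f : ℕ → ℝ} {P : ℕ → Prop} {L : ℝ}
    (h : Filter.Tendsto f (Filter.atTop ⊓ Filter.principal {n | P n}) (nhds L)) :
    ∃ C, 0 < C ∧ ∀ n, P n → f n ≤ C := by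
  have h1 := h.eventually_lt_const (lt_add_one L)
  rw [Filter.eventually_inf_principal, Filter.eventually_atTop] at h1
  obtain ⟨N, hN⟩ := h1
  have h0 : 0 ≤ ∑ i ∈ Finset.range N, |f i| := Finset.sum_nonneg fun _ _ => abs_nonneg _
  refine ⟨|L| + 1 + ∑ i ∈ Finset.range N, |f i|, by positivity, fun n hn => ?_⟩
  rcases lt_or_ge n N with hnN | hnN
  · have h2 := Finset.single_le_sum (f := fun i => |f i|) (fun _ _ => abs_nonneg _)
      (Finset.mem_range.2 hnN)
    have h3 := le_abs_self (f n)
    have h4 := abs_nonneg L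
    linarith
  · have h2 := hN n hnN hn
    have h4 := le_abs_self L
    linarith

theorem log_prod_one_add_R_mul_asymp (κ : ℝ) (hκ : 1 < κ) (R : ℕ → ℝ)
    (hRpos : ∀ p : ℕ, p.Prime → 0 < R p)
    (hRasymp : Filter.Tendsto (fun p : ℕ => R p * (p : ℝ) ^ κ)
      (Filter.atTop ⊓ Filter.principal {p : ℕ | p.Prime}) (nhds 1)) :
    (∀ x : ℝ, 0 < x → Multipliable fun p : Nat.Primes => 1 + R p * x) ∧
    ∃ c₁ c₂ x₀ : ℝ, 0 < c₁ ∧ 0 < c₂ ∧ ∀ x : ℝ, x₀ ≤ x →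
      c₁ * (x ^ (1 / κ) / Real.log x) ≤
        Real.log (∏' p : Nat.Primes, (1 + R p * x)) ∧
      Real.log (∏' p : Nat.Primes, (1 + R p * x)) ≤
        c₂ * (x ^ (1 / κ) / Real.log x) := by
  obtain ⟨C, hC, hRC⟩ := exists_forall_le_of_tendsto_inf_principal hRasymp
  obtain ⟨D, hD, hRD⟩ := exists_forall_le_of_tendsto_inf_principal (hRasymp.inv₀ one_ne_zero)
  have hpκ : ∀ p : ℕ, p.Prime → (0 : ℝ) < (p : ℝ) ^ κ := fun p hp =>
    Real.rpow_pos_of_pos (by exact_mod_cast hp.pos) _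
  have hsum : Summable fun p : Nat.Primes => R p := by
    refine ((Nat.Primes.summable_rpow.2 (show -κ < -1 by linarith)).mul_left C).of_nonneg_of_le
      (fun p => (hRpos p p.2).le) fun p => ?_
    rw [Real.rpow_neg (by positivity), ← div_eq_mul_inv, le_div_iff₀ (hpκ p p.2)]
    exact hRC p p.2
  have hpos : ∀ x : ℝ, 0 < x → ∀ p : Nat.Primes, 0 < 1 + R p * x := fun x hx p => by
    have := mul_pos (hRpos p p.2) hx
    linarith
  have hlogsum : ∀ x : ℝ, Summable fun p : Nat.Primes => Real.log (1 + R p * x) := fun x =>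
    Real.summable_log_one_add_of_summable (hsum.mul_right x)
  refine ⟨fun x hx => Real.multipliable_of_summable_log (hpos x hx) (hlogsum x), ?_⟩
  have hD1 : 0 < Real.log (1 + D⁻¹) := Real.log_pos (by simpa using hD)
  have hκ0 : 0 < κ := by linarith
  have hκ1 : 0 < κ - 1 := by linarith
  have hl4 : 0 < Real.log 4 := Real.log_pos (by norm_num)
  refine ⟨Real.log (1 + D⁻¹) * (κ / 4),
    9 * (C + 4 * κ) * Real.log 4 * (2 + 2 ^ (κ - 1) / (κ - 1)) * κ, 10 ^ κ,
    by positivity, by positivity, fun x hx => ?_⟩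
  have hx0 : 0 < x := lt_of_lt_of_le (by positivity) hx
  obtain ⟨y, hy⟩ : ∃ y, y = x ^ (1 / κ) := ⟨_, rfl⟩
  have hy10 : 10 ≤ y := by
    rw [hy, one_div, Real.le_rpow_inv_iff_of_pos (by norm_num) hx0.le hκ0]
    exact hx
  have hy0 : 0 < y := by linarith
  have hyx : y ^ κ = x := by
    rw [hy, ← Real.rpow_mul hx0.le, one_div_mul_cancel hκ0.ne', Real.rpow_one]
  have hlx : Real.log x = κ * Real.log y := by rw [← hyx, Real.log_rpow hy0]
  have hly := Real.log_pos (show 1 < y by linarith)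
  rw [← hy, hlx, ← Real.rexp_tsum_eq_tprod (hpos x hx0) (hlogsum x), Real.log_exp]
  let F : ℕ → ℝ := fun n => Real.log (1 + R n * x)
  have hF0 : ∀ n, 0 ≤ Set.indicator {p : ℕ | p.Prime} F n := fun n =>
    Set.indicator_nonneg (fun p hp => Real.log_nonneg (by
      have := mul_pos (hRpos p hp) hx0
      linarith)) n
  have hFsum : Summable (Set.indicator {p : ℕ | p.Prime} F) :=
    summable_subtype_iff_indicator.1 (hlogsum x)
  have hFt : ∑' p : Nat.Primes, Real.log (1 + R p * x) =
      ∑' n, Set.indicator {p : ℕ | p.Prime} F n := tsum_subtype {p : ℕ | p.Prime} F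
  have hpart : ∀ N, ∑ n ∈ Finset.range (N + 1), Set.indicator {p : ℕ | p.Prime} F n =
      ∑ p ∈ Nat.primesLE N, F p := fun N => by
    rw [Nat.primesLE_eq_filter_range, Finset.sum_filter]
    simp [Set.indicator_apply]
  rw [hFt]
  constructor
  · calc _ = Real.log (1 + D⁻¹) * (y / (4 * Real.log y)) := by field_simp
      _ ≤ Real.log (1 + D⁻¹) * Nat.primeCounting ⌊y⌋₊ := by
        gcongr
        exact div_four_mul_log_le_primeCounting hy10
      _ = ∑ p ∈ Nat.primesLE ⌊y⌋₊, Real.log (1 + D⁻¹) := by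
        rw [Finset.sum_const, Nat.primesLE_card_eq_primeCounting, nsmul_eq_mul, mul_comm]
      _ ≤ ∑ p ∈ Nat.primesLE ⌊y⌋₊, F p := by
        refine Finset.sum_le_sum fun p hp => Real.log_le_log (by positivity) ?_
        have hpp := Nat.prime_of_mem_primesLE hp
        have hpy : (p : ℝ) ≤ y :=
          (Nat.le_floor_iff hy0.le).1 (Nat.le_of_mem_primesLE hp)
        have h1 : (p : ℝ) ^ κ ≤ x := by
          rw [← hyx]
          gcongr
        have h2 : D⁻¹ ≤ R p * (p : ℝ) ^ κ :=
          inv_le_of_inv_le₀ (mul_pos (hRpos p hpp) (hpκ p hpp)) (hRD p hpp)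
        have h3 := mul_le_mul_of_nonneg_left h1 (hRpos p hpp).le
        linarith
      _ ≤ _ := by
        rw [← hpart]
        exact hFsum.sum_le_tsum _ fun n _ => hF0 n
  · refine Real.tsum_le_of_sum_range_le hF0 fun N => ?_
    calc _ ≤ ∑ n ∈ Finset.range (N + 1), Set.indicator {p : ℕ | p.Prime} F n :=
          Finset.sum_le_sum_of_subset_of_nonneg (Finset.range_subset_range.2 (Nat.le_succ N))
            fun n _ _ => hF0 n
      _ = ∑ p ∈ Nat.primesLE N, F p := hpart N
      _ ≤ ∑ p ∈ Nat.primesLE N, Real.log (1 + C * (y / p) ^ κ) := by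
        refine Finset.sum_le_sum fun p hp => ?_
        have hpp := Nat.prime_of_mem_primesLE hp
        refine Real.log_le_log (hpos x hx0 ⟨p, hpp⟩) ?_
        rw [Real.div_rpow hy0.le (by positivity), hyx, add_le_add_iff_left, mul_div_assoc',
          le_div_iff₀ (hpκ p hpp)]
        have := mul_le_mul_of_nonneg_right (hRC p hpp) hx0.le
        linarith
      _ ≤ _ := sum_primesLE_log_one_add_le hκ hC.le (by linarith) N
      _ = _ := by field_simp
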